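/- (Monotonicity.) Let P₀, P₁ be ancestor-to-descendant paths in T that are either orthogonal or such that one lies strictly above the other on a common root-to-leaf path. Let v₀ be the endpoint of P₀ closest in T to P₁, let v₁ be the endpoint of P₁ closest in T to P₀, and let t be any vertex on the tree path between v₀ and v₁. For edges f, f' on the same path Pᵢ, say f' is closer to t than f if f' lies on the tree path between f and t. Let E₀ be a nonempty set of edges of P₀ and E₁ a nonempty set of edges of P₁, and for e ∈ E₀ let m(e) denote the edge of E₁ that is closest to t among those minimizing Cut(e, ·) over E₁. Then m is monotone: if e⁰₁, e⁰₂ ∈ E₀ and e⁰₂ is closer to t than e⁰₁, then either m(e⁰₂) = m(e⁰₁) or m(e⁰₂) is closer to t than m(e⁰₁). -/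

import Mathlib

open SimpleGraph

variable {V : Type}

/-- `a` is a (weak) ancestor of `v` in the tree `T` rooted at `r`:
`a` lies on every `T`-path from `v` to `r`. -/
def IsAnc (T : SimpleGraph V) (r a v : V) : Prop :=
  ∀ p : T.Path v r, a ∈ p.1.support

/-- The edge `x` crosses the bipartition `(S, Sᶜ)`. -/
def Crosses (S : Set V) (x : Sym2 V) : Prop :=
  ∃ a b : V, x = s(a, b) ∧ a ∈ S ∧ b ∉ S

/-- Total weight of a set of edges. -/
noncomputable def setW (w : Sym2 V → ℕ) (S : Set (Sym2 V)) : ℕ :=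
  ∑ᶠ x ∈ S, w x

/-- Two tree edges are orthogonal: they do not lie on a common descending path
from the root (equivalently, on a common root-to-leaf path). -/
def OrthE (T : SimpleGraph V) (r : V) (f g : Sym2 V) : Prop :=
  ¬ ∃ (u : V) (q : T.Path r u), f ∈ q.1.edges ∧ g ∈ q.1.edges

/-- Two paths are orthogonal if every edge of one is orthogonal to every edge
of the other. -/
def pathOrth (T : SimpleGraph V) (r : V) {a b a' b' : V}
    (p : T.Path a b) (p' : T.Path a' b') : Prop :=
  ∀ f ∈ p.1.edges, ∀ g ∈ p'.1.edges, OrthE T r f g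

/-- The edge `f'` lies (strictly) on the tree path between the edge `f` and the
vertex `t`, i.e. `f'` is closer to `t` than `f`. -/
def EdgeCloser (T : SimpleGraph V) (t : V) (f' f : Sym2 V) : Prop :=
  ∀ x y : V, f = s(x, y) →
    (∀ p : T.Path x t, f' ∈ p.1.edges) ∧ (∀ p : T.Path y t, f' ∈ p.1.edges)

/-- The vertices separated from `t` by the edge `e`, in a tree `T`. -/
def awaySide (T : SimpleGraph V) (t : V) (e : Sym2 V) : Set V :=
  {x | ∀ p : T.Path x t, e ∈ p.1.edges}

section Tree

variable {T : SimpleGraph V}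

theorem mem_awaySide_iff (hT : T.IsTree) {x t : V} {e : Sym2 V} {p : T.Walk x t}
    (hp : p.IsPath) : x ∈ awaySide T t e ↔ e ∈ p.edges := by
  refine ⟨fun h => h ⟨p, hp⟩, fun h q => ?_⟩
  rw [(hT.isAcyclic.subsingleton_path x t).elim q ⟨p, hp⟩]
  exact h

theorem exists_isPath (hT : T.IsTree) (x y : V) : ∃ p : T.Walk x y, p.IsPath :=
  (hT.existsUnique_path x y).exists

theorem isPath_eq (hT : T.IsTree) {x y : V} {p q : T.Walk x y}
    (hp : p.IsPath) (hq : q.IsPath) : p = q :=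
  congrArg Subtype.val ((hT.isAcyclic.subsingleton_path x y).elim ⟨p, hp⟩ ⟨q, hq⟩)

/-- If a walk from `x` to `t` avoids `e`, then `x` is on the side of `t`. -/
theorem notMem_awaySide_of_walk {x t : V} {e : Sym2 V} (p : T.Walk x t)
    (he : e ∉ p.edges) : x ∉ awaySide T t e := by
  classical
  exact fun h => he (p.edges_bypass_subset_edges (h ⟨p.bypass, p.bypass_isPath⟩))

theorem eq_of_crosses_awaySide (hT : T.IsTree) {t : V} {e g : Sym2 V}
    (hg : g ∈ T.edgeSet) (h : Crosses (awaySide T t e) g) : g = e := by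
  obtain ⟨a, b, rfl, ha, hb⟩ := h
  obtain ⟨q, hq⟩ := exists_isPath hT b t
  rw [mem_awaySide_iff hT hq] at hb
  by_contra hne
  refine notMem_awaySide_of_walk (Walk.cons (T.mem_edgeSet.1 hg) q) ?_ ha
  simp only [Walk.edges_cons, List.mem_cons, not_or]
  exact ⟨fun h => hne h.symm, hb⟩

theorem crosses_awaySide_self (hT : T.IsTree) (t : V) {e : Sym2 V} (he : e ∈ T.edgeSet) :
    Crosses (awaySide T t e) e := by
  classical
  induction e using Sym2.ind with
  | _ a b =>
  have hab : T.Adj a b := he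
  obtain ⟨q, hq⟩ := exists_isPath hT b t
  by_cases hmem : s(a, b) ∈ q.edges
  · refine ⟨b, a, Sym2.eq_swap, (mem_awaySide_iff hT hq).2 hmem, ?_⟩
    cases q with
    | nil => simp at hmem
    | cons h q' =>
      rw [Walk.cons_isPath_iff] at hq
      have hnot : s(a, b) ∉ q'.edges := fun h' => hq.2 (q'.snd_mem_support_of_mem_edges h')
      rw [Walk.edges_cons, List.mem_cons] at hmem
      rcases hmem with hmem | hmem
      · rw [Sym2.eq_swap, Sym2.congr_right] at hmem
        subst hmem
        exact notMem_awaySide_of_walk q' hnot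
      · exact absurd hmem hnot
  · refine ⟨a, b, rfl, ?_, notMem_awaySide_of_walk q hmem⟩
    by_cases ha : a ∈ q.support
    · have h1 : q.takeUntil a ha = Walk.cons hab.symm Walk.nil :=
        isPath_eq hT (hq.takeUntil ha) (by simp [hab.ne'])
      have h2 : s(a, b) ∈ (q.takeUntil a ha).edges := by
        rw [h1]; simp [Sym2.eq_swap]
      exact absurd (q.edges_takeUntil_subset_edges ha h2) hmem
    · rw [mem_awaySide_iff hT (p := Walk.cons hab q) ((Walk.cons_isPath_iff _ _).2 ⟨hq, ha⟩)]
      simp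

theorem awaySide_subset_of_edgeCloser (hT : T.IsTree) {t : V} {e e' : Sym2 V}
    (h : EdgeCloser T t e' e) : awaySide T t e ⊆ awaySide T t e' := by
  classical
  induction e using Sym2.ind with
  | _ x y =>
  intro z hz
  obtain ⟨q, hq⟩ := exists_isPath hT z t
  rw [mem_awaySide_iff hT hq] at hz ⊢
  have hx : x ∈ q.support := q.fst_mem_support_of_mem_edges hz
  exact q.edges_dropUntil_subset_edges hx ((h x y rfl).1 ⟨_, hq.dropUntil hx⟩)

theorem edgeCloser_total_of_mem_edges (hT : T.IsTree) {x t : V} {p : T.Walk x t}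
    (hp : p.IsPath) {f g : Sym2 V} (hf : f ∈ p.edges) (hg : g ∈ p.edges) :
    f = g ∨ EdgeCloser T t f g ∨ EdgeCloser T t g f := by
  have key : ∀ {a b : V} (h : T.Adj a b) (q : T.Walk b t), (Walk.cons h q).IsPath →
      ∀ f ∈ q.edges, EdgeCloser T t f s(a, b) := by
    intro a b h q hq f hf
    have h1 : a ∈ awaySide T t f := (mem_awaySide_iff hT hq).2 (by simp [hf])
    have h2 : b ∈ awaySide T t f := (mem_awaySide_iff hT hq.of_cons).2 hf
    intro c d hcd
    rcases Sym2.eq_iff.1 hcd with ⟨rfl, rfl⟩ | ⟨rfl, rfl⟩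
    · exact ⟨h1, h2⟩
    · exact ⟨h2, h1⟩
  induction p with
  | nil => simp at hf
  | cons h q ih =>
    rw [Walk.edges_cons, List.mem_cons] at hf hg
    rcases hf with rfl | hf <;> rcases hg with rfl | hg
    · exact Or.inl rfl
    · exact Or.inr (Or.inr (key h q hp g hg))
    · exact Or.inr (Or.inl (key h q hp f hf))
    · exact ih hp.of_cons hf hg key

theorem isPath_append_of_forall_mem_support (hT : T.IsTree) {u v w : V} {p : T.Walk u v}
    {q : T.Walk v w} (hp : p.IsPath) (hq : q.IsPath)
    (h : ∀ c : T.Path u w, v ∈ c.1.support) : (p.append q).IsPath := by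
  classical
  obtain ⟨c, hc⟩ := exists_isPath hT u w
  have hv := h ⟨c, hc⟩
  rw [isPath_eq hT hp (hc.takeUntil hv), isPath_eq hT hq (hc.dropUntil hv), Walk.take_spec]
  exact hc

theorem disjoint_edges_of_isPath_append {u v w : V} {p : T.Walk u v} {q : T.Walk v w}
    (h : (p.append q).IsPath) : List.Disjoint p.edges q.edges := by
  have := h.isTrail.edges_nodup
  rw [Walk.edges_append] at this
  exact List.disjoint_of_nodup_append this

theorem IsAnc.trans {r a b c : V} (hab : IsAnc T r a b) (hbc : IsAnc T r b c) :
    IsAnc T r a c := by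
  classical
  exact fun p => p.1.support_dropUntil_subset_support (hbc p) (hab ⟨_, p.2.dropUntil (hbc p)⟩)

theorem IsAnc.antisymm (hT : T.IsTree) {r a b : V} (hab : IsAnc T r a b)
    (hba : IsAnc T r b a) : a = b := by
  classical
  obtain ⟨p, hp⟩ := exists_isPath hT a r
  have hb := hba ⟨p, hp⟩
  cases p with
  | nil =>
    rw [Walk.support_nil, List.mem_singleton] at hb
    exact hb.symm
  | cons h q =>
    rw [Walk.cons_isPath_iff] at hp
    rw [Walk.support_cons, List.mem_cons] at hb
    rcases hb with hb | hb
    · exact hb.symm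
    · exact absurd (q.support_dropUntil_subset_support hb (hab ⟨_, hp.1.dropUntil hb⟩)) hp.2

/-- On a descending path from `a` to `b`, every vertex lies between `a` and `b` in the
ancestor order. -/
theorem IsAnc.of_mem_support (hT : T.IsTree) {r a b x : V} (hab : IsAnc T r a b)
    {p : T.Walk a b} (hp : p.IsPath) (hx : x ∈ p.support) :
    IsAnc T r a x ∧ IsAnc T r x b := by
  classical
  obtain ⟨c, hc⟩ := exists_isPath hT a r
  have hpath := isPath_append_of_forall_mem_support hT hp.reverse hc hab
  have hx' : x ∈ p.reverse.support := by simpa using hx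
  constructor
  · intro q
    have hsplit : ((p.reverse.takeUntil x hx').append
        ((p.reverse.dropUntil x hx').append c)).IsPath := by
      rwa [Walk.append_assoc, Walk.take_spec]
    rw [show q.1 = (p.reverse.dropUntil x hx').append c from
      isPath_eq hT q.2 hsplit.of_append_right]
    simp [Walk.mem_support_append_iff]
  · intro q
    rw [isPath_eq hT q.2 hpath, Walk.mem_support_append_iff]
    exact Or.inl hx'

theorem disjoint_edges_of_isAnc (hT : T.IsTree) {r a b a' b' : V} {p : T.Walk a b}
    {p' : T.Walk a' b'} (hp : p.IsPath) (hp' : p'.IsPath) (hab : IsAnc T r a b)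
    (hab' : IsAnc T r a' b') (h : IsAnc T r b a') : List.Disjoint p.edges p'.edges := by
  intro f hf hf'
  induction f using Sym2.ind with
  | _ x y =>
  have key : ∀ z ∈ p.support, z ∈ p'.support → z = b := fun z hz hz' =>
    IsAnc.antisymm hT (hab.of_mem_support hT hp hz).2
      (h.trans (hab'.of_mem_support hT hp' hz').1)
  refine (p.adj_of_mem_edges hf).ne ?_
  rw [key x (p.fst_mem_support_of_mem_edges hf) (p'.fst_mem_support_of_mem_edges hf'),
    key y (p.snd_mem_support_of_mem_edges hf) (p'.snd_mem_support_of_mem_edges hf')]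

theorem not_orthE_self (hT : T.IsTree) (r : V) {f : Sym2 V} (hf : f ∈ T.edgeSet) :
    ¬ OrthE T r f f := by
  obtain ⟨a, -, -, ha, -⟩ := crosses_awaySide_self hT r hf
  obtain ⟨q, hq⟩ := exists_isPath hT a r
  have := ha ⟨q, hq⟩
  exact not_not.2 ⟨a, ⟨q.reverse, hq.reverse⟩, by simpa using this, by simpa using this⟩

theorem exists_isPath_to_endpoint {a b v : V} (p : T.Path a b) (hv : v = a ∨ v = b) :
    ∃ u ∈ p.1.support, ∃ q : T.Walk u v, q.IsPath ∧ ∀ e, e ∈ q.edges ↔ e ∈ p.1.edges := by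
  rcases hv with rfl | rfl
  · exact ⟨b, p.1.end_mem_support, p.1.reverse, p.2.reverse, by simp⟩
  · exact ⟨a, p.1.start_mem_support, p.1, p.2, by simp⟩

theorem disjoint_awaySide (hT : T.IsTree) {t u u' : V} {p : T.Walk u t} {p' : T.Walk u' t}
    (hp : p.IsPath) (hp' : p'.IsPath) (hdisj : List.Disjoint p.edges p'.edges)
    {e f : Sym2 V} (he : e ∈ p.edges) (hf : f ∈ p'.edges) :
    Disjoint (awaySide T t e) (awaySide T t f) := by
  rw [Set.disjoint_left]
  intro z hze hzf
  obtain ⟨q, hq⟩ := exists_isPath hT z t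
  rw [mem_awaySide_iff hT hq] at hze hzf
  rcases edgeCloser_total_of_mem_edges hT hq hze hzf with rfl | h | h
  · exact hdisj he hf
  · have := awaySide_subset_of_edgeCloser hT h ((mem_awaySide_iff hT hp').2 hf)
    exact hdisj he ((mem_awaySide_iff hT hp').1 this)
  · have := awaySide_subset_of_edgeCloser hT h ((mem_awaySide_iff hT hp).2 he)
    exact hdisj ((mem_awaySide_iff hT hp).1 this) hf

/-- Two edges with disjoint far sides are exactly the tree edges crossing the union of
these sides. -/
theorem crossing_awaySide_union (hT : T.IsTree) {t : V} {e f : Sym2 V}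
    (he : e ∈ T.edgeSet) (hf : f ∈ T.edgeSet)
    (hd : Disjoint (awaySide T t e) (awaySide T t f)) :
    {g : Sym2 V | g ∈ T.edgeSet ∧ Crosses (awaySide T t e ∪ awaySide T t f) g} = {e, f} := by
  have hself : ∀ {e f : Sym2 V}, e ∈ T.edgeSet →
      Disjoint (awaySide T t e) (awaySide T t f) →
      Crosses (awaySide T t e ∪ awaySide T t f) e := by
    intro e f he hd
    obtain ⟨a, b, hab, ha, hb⟩ := crosses_awaySide_self hT t he
    refine ⟨a, b, hab, Or.inl ha, fun h => h.elim hb fun hbf => ?_⟩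
    have := eq_of_crosses_awaySide hT he
      ⟨b, a, hab.trans Sym2.eq_swap, hbf, Set.disjoint_left.1 hd ha⟩
    exact hb (this ▸ hbf)
  ext g
  simp only [Set.mem_ofPred_eq, Set.mem_insert_iff, Set.mem_singleton_iff]
  constructor
  · rintro ⟨hg, a, b, hab, ha | ha, hb⟩
    · exact Or.inl (eq_of_crosses_awaySide hT hg ⟨a, b, hab, ha, fun h => hb (Or.inl h)⟩)
    · exact Or.inr (eq_of_crosses_awaySide hT hg ⟨a, b, hab, ha, fun h => hb (Or.inr h)⟩)
  · rintro (rfl | rfl)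
    · exact ⟨he, hself he hd⟩
    · exact ⟨hf, Set.union_comm _ _ ▸ hself hf hd.symm⟩

end Tree

theorem union_inter_union_of_subset {A A' B B' : Set V} (hA : A ⊆ A') (hB : B ⊆ B')
    (h : Disjoint A' B') : (A' ∪ B) ∩ (A ∪ B') = A ∪ B := by
  ext z
  have hzA := @hA z
  have hzB := @hB z
  have hz : z ∈ A' → z ∉ B' := fun hz => Set.disjoint_left.1 h hz
  simp only [Set.mem_inter_iff, Set.mem_union]
  tauto

theorem crosses_mk_iff {S : Set V} {a b : V} :
    Crosses S s(a, b) ↔ (a ∈ S ∧ b ∉ S) ∨ (b ∈ S ∧ a ∉ S) := by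
  constructor
  · rintro ⟨c, d, h, hc, hd⟩
    rcases Sym2.eq_iff.1 h with ⟨rfl, rfl⟩ | ⟨rfl, rfl⟩
    · exact Or.inl ⟨hc, hd⟩
    · exact Or.inr ⟨hc, hd⟩
  · rintro (h | h)
    · exact ⟨a, b, rfl, h⟩
    · exact ⟨b, a, Sym2.eq_swap, h⟩

/-- The weight of the edges in `E` leaving a vertex set is a submodular function. -/
theorem setW_crosses_submodular [Finite V] (w : Sym2 V → ℕ) (E : Set (Sym2 V)) (X Y : Set V) :
    setW w {x ∈ E | Crosses (X ∪ Y) x} + setW w {x ∈ E | Crosses (X ∩ Y) x} ≤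
      setW w {x ∈ E | Crosses X x} + setW w {x ∈ E | Crosses Y x} := by
  classical
  have := Fintype.ofFinite V
  have hsum : ∀ S : Set V, setW w {x ∈ E | Crosses S x} =
      ∑ x, if x ∈ E ∧ Crosses S x then w x else 0 := by
    intro S
    rw [setW, finsum_mem_eq_finite_toFinset_sum _ (Set.toFinite _), ← Finset.sum_filter]
    congr 1
    ext x
    simp
  simp only [hsum, ← Finset.sum_add_distrib]
  refine Finset.sum_le_sum fun x _ => ?_
  by_cases hx : x ∈ E
  · induction x using Sym2.ind with
    | _ a b =>
    simp only [hx, true_and, crosses_mk_iff, Set.mem_union, Set.mem_inter_iff]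
    by_cases h1 : a ∈ X <;> by_cases h2 : b ∈ X <;> by_cases h3 : a ∈ Y <;>
      by_cases h4 : b ∈ Y <;> simp [h1, h2, h3, h4]
  · simp [hx]

/-- Monotonicity.  Let `P₀`, `P₁` be ancestor-to-descendant paths that
are orthogonal or one strictly above the other, `v₀`/`v₁` the endpoints of `P₀`/`P₁`
closest to the other path, and `t` a vertex on the tree path between `v₀` and `v₁`.
For `e ∈ E₀ ⊆ P₀` let `m e ∈ E₁ ⊆ P₁` be the minimizer of `Cut(e, ·)` over `E₁`
that is closest to `t`.  Then `m` is monotone with respect to closeness to `t`. -/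
theorem cut_minimizer_monotone [Fintype V]
    (G T : SimpleGraph V) (hG : G.Connected) (hle : T ≤ G) (hT : T.IsTree)
    (w : Sym2 V → ℕ) (hw : ∀ x ∈ G.edgeSet, 1 ≤ w x) (r : V)
    {a₀ b₀ a₁ b₁ : V} (p₀ : T.Path a₀ b₀) (p₁ : T.Path a₁ b₁)
    (hd₀ : IsAnc T r a₀ b₀) (hd₁ : IsAnc T r a₁ b₁)
    (hconfig : pathOrth T r p₀ p₁ ∨ IsAnc T r b₀ a₁ ∨ IsAnc T r b₁ a₀)
    (v₀ v₁ t : V)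
    (hv₀ : v₀ = a₀ ∨ v₀ = b₀) (hv₁ : v₁ = a₁ ∨ v₁ = b₁)
    (hclosest₀ : ∀ u ∈ p₀.1.support, ∀ q : T.Path u v₁, v₀ ∈ q.1.support)
    (hclosest₁ : ∀ u ∈ p₁.1.support, ∀ q : T.Path u v₀, v₁ ∈ q.1.support)
    (ht : ∀ q : T.Path v₀ v₁, t ∈ q.1.support)
    (cut : Sym2 V → Sym2 V → ℕ)
    (hcut : ∀ (e e' : Sym2 V) (S : Set V),
      {f : Sym2 V | f ∈ T.edgeSet ∧ Crosses S f} = {e, e'} →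
      cut e e' = setW w {x ∈ G.edgeSet | Crosses S x})
    (E₀ E₁ : Set (Sym2 V))
    (hE₀ : ∀ f ∈ E₀, f ∈ p₀.1.edges) (hE₁ : ∀ f ∈ E₁, f ∈ p₁.1.edges)
    (hE₀ne : E₀.Nonempty) (hE₁ne : E₁.Nonempty)
    (m : Sym2 V → Sym2 V)
    (hm : ∀ e ∈ E₀, m e ∈ E₁ ∧ (∀ f ∈ E₁, cut e (m e) ≤ cut e f) ∧
      ∀ f ∈ E₁, (∀ g ∈ E₁, cut e f ≤ cut e g) →
        f = m e ∨ EdgeCloser T t (m e) f) :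
    ∀ e₁ ∈ E₀, ∀ e₂ ∈ E₀, EdgeCloser T t e₂ e₁ →
      m e₂ = m e₁ ∨ EdgeCloser T t (m e₂) (m e₁) := by
  obtain ⟨u₀, hu₀, P₀, hP₀, hP₀e⟩ := exists_isPath_to_endpoint p₀ hv₀
  obtain ⟨u₁, hu₁, P₁, hP₁, hP₁e⟩ := exists_isPath_to_endpoint p₁ hv₁
  have hdisjP : List.Disjoint P₀.edges P₁.edges := by
    intro f hf₀ hf₁
    rw [hP₀e] at hf₀
    rw [hP₁e] at hf₁
    rcases hconfig with h | h | h
    · exact not_orthE_self hT r (p₀.1.edges_subset_edgeSet hf₀) (h f hf₀ f hf₁)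
    · exact disjoint_edges_of_isAnc hT p₀.2 p₁.2 hd₀ hd₁ h hf₀ hf₁
    · exact disjoint_edges_of_isAnc hT p₁.2 p₀.2 hd₁ hd₀ h hf₁ hf₀
  obtain ⟨L, M, hL, hM, hLM, hPL, hPM⟩ : ∃ (L : T.Walk u₀ t) (M : T.Walk u₁ t),
      L.IsPath ∧ M.IsPath ∧ List.Disjoint L.edges M.edges ∧
        P₀.edges ⊆ L.edges ∧ P₁.edges ⊆ M.edges := by
    obtain ⟨Q, hQ⟩ := exists_isPath hT v₀ v₁
    obtain ⟨Q₀, Q₁, rfl⟩ := Walk.mem_support_iff_exists_append.1 (ht ⟨Q, hQ⟩)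
    have h₀ := isPath_append_of_forall_mem_support hT hP₀ hQ (hclosest₀ u₀ hu₀)
    have h₁ := isPath_append_of_forall_mem_support hT hP₁ hQ.reverse (hclosest₁ u₁ hu₁)
    have d₀ := disjoint_edges_of_isPath_append h₀
    have d₁ := disjoint_edges_of_isPath_append h₁
    have dQ := disjoint_edges_of_isPath_append hQ
    rw [Walk.reverse_append] at h₁
    rw [Walk.append_assoc] at h₀ h₁
    refine ⟨P₀.append Q₀, P₁.append Q₁.reverse, h₀.of_append_left, h₁.of_append_left, ?_,
      by simp [Walk.edges_append], by simp [Walk.edges_append]⟩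
    intro f hf hf'
    simp only [Walk.edges_append, Walk.edges_reverse, List.mem_append, List.mem_reverse]
      at hf hf'
    rcases hf with hf | hf <;> rcases hf' with hf' | hf'
    · exact hdisjP hf hf'
    · exact d₀ hf (by simp [Walk.edges_append, hf'])
    · exact d₁ hf' (by simp [Walk.edges_append, hf])
    · exact dQ hf hf'
  have hE₀L : ∀ e ∈ E₀, e ∈ L.edges := fun e he => hPL ((hP₀e e).2 (hE₀ e he))
  have hE₁M : ∀ f ∈ E₁, f ∈ M.edges := fun f hf => hPM ((hP₁e f).2 (hE₁ f hf))
  have hsides : ∀ e ∈ E₀, ∀ f ∈ E₁, Disjoint (awaySide T t e) (awaySide T t f) :=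
    fun e he f hf => disjoint_awaySide hT hL hM hLM (hE₀L e he) (hE₁M f hf)
  have hval : ∀ e ∈ E₀, ∀ f ∈ E₁, cut e f =
      setW w {x ∈ G.edgeSet | Crosses (awaySide T t e ∪ awaySide T t f) x} :=
    fun e he f hf => hcut e f _ (crossing_awaySide_union hT
      (L.edges_subset_edgeSet (hE₀L e he)) (M.edges_subset_edgeSet (hE₁M f hf))
      (hsides e he f hf))
  intro e₁ he₁ e₂ he₂ hcl
  obtain ⟨hf₁, hmin₁, -⟩ := hm e₁ he₁
  obtain ⟨hf₂, hmin₂, hbest₂⟩ := hm e₂ he₂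
  rcases edgeCloser_total_of_mem_edges hT hM (hE₁M _ hf₂) (hE₁M _ hf₁) with h | h | h
  · exact Or.inl h
  · exact Or.inr h
  have hA := awaySide_subset_of_edgeCloser hT hcl
  have hB := awaySide_subset_of_edgeCloser hT h
  have hAB := hsides e₂ he₂ _ hf₁
  have hsub := setW_crosses_submodular w G.edgeSet
    (awaySide T t e₂ ∪ awaySide T t (m e₂)) (awaySide T t e₁ ∪ awaySide T t (m e₁))
  have hunion : (awaySide T t e₂ ∪ awaySide T t (m e₂)) ∪
      (awaySide T t e₁ ∪ awaySide T t (m e₁)) = awaySide T t e₂ ∪ awaySide T t (m e₁) := by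
    rw [Set.union_union_union_comm, Set.union_eq_left.2 hA, Set.union_eq_right.2 hB]
  have hinter : (awaySide T t e₂ ∪ awaySide T t (m e₂)) ∩
      (awaySide T t e₁ ∪ awaySide T t (m e₁)) = awaySide T t e₁ ∪ awaySide T t (m e₂) :=
    union_inter_union_of_subset hA hB hAB
  rw [hunion, hinter, ← hval e₂ he₂ _ hf₁, ← hval e₁ he₁ _ hf₂, ← hval e₂ he₂ _ hf₂,
    ← hval e₁ he₁ _ hf₁] at hsub
  have hle₁ := hmin₁ _ hf₂
  exact (hbest₂ _ hf₁ fun g hg => by have := hmin₂ g hg; omega).imp_left Eq.symm
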